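/- arXiv:1911.10991 — 3 statements merged into one kernel-verified Lean document; each statement's English description precedes it below -/
import Mathlib

section
/- Let k ≥ 1 and d ≥ 1 be integers and let m'_1, ..., m'_k be nonnegative integers with m'_1 + ... + m'_k = N'. Then the multinomial coefficient satisfies (dN')!/((dm'_1)!···(dm'_k)!) ≥ ( N'!/(m'_1!···m'_k!) )^d. -/
theorem Nat.choose_mul_choose_le_choose_add (a b c e : ℕ) :
    a.choose b * c.choose e ≤ (a + c).choose (b + e) := by
  rw [Nat.add_choose_eq]
  exact Finset.single_le_sum (f := fun ij : ℕ × ℕ => a.choose ij.1 * c.choose ij.2)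
    (a := (b, e)) (fun _ _ => Nat.zero_le _) (by simp)

theorem Nat.multinomial_mul_multinomial_le_multinomial_add {α : Type*} (s : Finset α)
    (f g : α → ℕ) :
    Nat.multinomial s f * Nat.multinomial s g ≤ Nat.multinomial s (fun i => f i + g i) := by
  induction s using Finset.cons_induction with
  | empty => simp
  | cons a s ha ih =>
    simp only [Nat.multinomial_cons ha]
    rw [mul_mul_mul_comm, Finset.sum_add_distrib, add_add_add_comm]
    exact Nat.mul_le_mul (Nat.choose_mul_choose_le_choose_add _ _ _ _) ih

theorem Nat.multinomial_pow_le_multinomial_mul {α : Type*} (s : Finset α) (f : α → ℕ) (d : ℕ) :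
    Nat.multinomial s f ^ d ≤ Nat.multinomial s (fun i => d * f i) := by
  induction d with
  | zero => simp [Nat.multinomial]
  | succ d ih =>
    simp only [pow_succ, add_one_mul]
    exact (Nat.mul_le_mul_right _ ih).trans
      (Nat.multinomial_mul_multinomial_le_multinomial_add s _ f)

/-- For `k ≥ 1`, `d ≥ 1` and nonnegative integers `m'_1, …, m'_k` with sum `N'`, the multinomial
coefficients satisfy `(d N')! / ((d m'_1)! ⋯ (d m'_k)!) ≥ (N'! / (m'_1! ⋯ m'_k!))^d`. -/
theorem stmt8 (k : ℕ) (hk : 1 ≤ k) (d : ℕ) (hd : 1 ≤ d)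
    (m : Fin k → ℕ) (N' : ℕ) (hN' : ∑ i, m i = N') :
    (Nat.multinomial Finset.univ m) ^ d
      ≤ Nat.multinomial Finset.univ (fun i => d * m i) :=
  Nat.multinomial_pow_le_multinomial_mul Finset.univ m d
end

section
/- Let k ≥ 1 and let z_1, ..., z_k be complex numbers with |z_1| + ... + |z_k| ≤ 1/2. Then the family ((1 − z_1^{m_1}···z_k^{m_k})^{M(m_1,...,m_k)}) indexed by k-tuples (m_1, ..., m_k) of nonnegative integers with m_1 + ... + m_k ≥ 1 is multipliable, and ∏_{m_1,...,m_k ≥ 0, m_1+...+m_k ≥ 1} (1 − z_1^{m_1}···z_k^{m_k})^{M(m_1,...,m_k)} = 1 − (z_1 + ... + z_k). -/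
/-- Witt's number
`M(m_1, …, m_k) = (1/N) Σ_{d ∣ gcd(m_1,…,m_k)} μ(d) (N/d)! / ((m_1/d)! ⋯ (m_k/d)!)`,
where `N = m_1 + ⋯ + m_k`, computed as a rational number. -/
def WittM {k : ℕ} (m : Fin k → ℕ) : ℚ :=
  (1 / ((∑ i, m i : ℕ) : ℚ)) *
    ∑ d ∈ (Finset.univ.gcd m).divisors,
      (ArithmeticFunction.moebius d : ℚ) *
        (Nat.multinomial Finset.univ (fun i => m i / d) : ℚ)

open Finset in
/-- Möbius inversion of the definition of `WittM`: summing `WittM (n / d) / d` over the common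
divisors `d` of `n` recovers the multinomial coefficient divided by the degree. -/
theorem sum_divisors_WittM_div {k : ℕ} (n : Fin k → ℕ) (hn : 1 ≤ ∑ i, n i) :
    ∑ d ∈ (univ.gcd n).divisors, WittM (fun i => n i / d) / d
      = (Nat.multinomial univ n : ℚ) / ((∑ i, n i : ℕ) : ℚ) := by
  set g := univ.gcd n with hg
  have hg0 : g ≠ 0 := by
    intro h
    rw [hg, Finset.gcd_eq_zero_iff] at h
    rw [Finset.sum_eq_zero h] at hn
    omega
  set G : ℕ → ℚ := fun e => Nat.multinomial univ (fun i => n i / (g / e))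
  set f : ℕ → ℚ := fun h =>
    ∑ x ∈ h.divisorsAntidiagonal, (ArithmeticFunction.moebius x.1 : ℚ) * G x.2 with hf
  have hinv : ∑ h ∈ g.divisors, f h = G g :=
    ArithmeticFunction.sum_eq_iff_sum_mul_moebius_eq.2 (fun _ _ => rfl) g (Nat.pos_of_ne_zero hg0)
  have hterm : ∀ d ∈ g.divisors, WittM (fun i => n i / d) / d
      = (1 / ((∑ i, n i : ℕ) : ℚ)) * f (g / d) := by
    intro d hd
    have hdg : d ∣ g := Nat.dvd_of_mem_divisors hd
    have hd0 : 0 < d := Nat.pos_of_mem_divisors hd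
    have hdn : ∀ i, d ∣ n i := fun i => hdg.trans (Finset.gcd_dvd (mem_univ i))
    have hgcd : univ.gcd (fun i => n i / d) = g / d := by
      have : g = d * univ.gcd (fun i => n i / d) := by
        rw [hg, show n = fun i => d * (n i / d) from
          funext fun i => (Nat.mul_div_cancel' (hdn i)).symm, Finset.gcd_mul_left]
        simp [hd0]
      rw [this, Nat.mul_div_cancel_left _ hd0]
    have hsum : ((∑ i, n i : ℕ) : ℚ) = d * ((∑ i, n i / d : ℕ) : ℚ) := by
      rw [← Nat.cast_mul, Finset.mul_sum]
      exact congrArg _ (Finset.sum_congr rfl fun i _ => (Nat.mul_div_cancel' (hdn i)).symm)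
    have hsub : ∑ e ∈ (g / d).divisors, (ArithmeticFunction.moebius e : ℚ) *
        (Nat.multinomial univ (fun i => n i / d / e) : ℚ) = f (g / d) := by
      rw [hf]
      simp only
      rw [Nat.sum_divisorsAntidiagonal
        (fun a b => (ArithmeticFunction.moebius a : ℚ) * G b)]
      refine Finset.sum_congr rfl fun e he => ?_
      have hdiv : g / (g / d / e) = d * e := by
        rw [Nat.div_div_eq_div_mul]
        exact Nat.div_div_self
          (Nat.mul_dvd_of_dvd_div hdg (Nat.dvd_of_mem_divisors he)) hg0
      simp only [G, hdiv]
      simp only [Nat.div_div_eq_div_mul]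
    rw [WittM, hgcd, hsub, hsum]
    field_simp
  rw [Finset.sum_congr rfl hterm, ← Finset.mul_sum, Nat.sum_div_divisors g f, hinv]
  simp only [G, Nat.div_self (Nat.pos_of_ne_zero hg0), Nat.div_one]
  rw [one_div_mul_eq_div]

/-- Tuples of positive degree, grouped by their degree. -/
def sigmaPiAntidiagEquiv (k : ℕ) :
    (Σ N : ℕ+, {n : Fin k → ℕ // n ∈ Finset.univ.piAntidiag (N : ℕ)}) ≃
      {m : Fin k → ℕ // 1 ≤ ∑ i, m i} where
  toFun x := ⟨x.2.1, by
    have h := (Finset.mem_piAntidiag.1 x.2.2).1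
    rw [h]; exact x.1.2⟩
  invFun m := ⟨⟨∑ i, m.1 i, m.2⟩, ⟨m.1, by simp⟩⟩
  left_inv := fun ⟨N, n, h⟩ => by
    refine Sigma.subtype_ext (p := fun N : ℕ+ => (· ∈ Finset.univ.piAntidiag (N : ℕ))) ?_ rfl
    exact PNat.eq (Finset.mem_piAntidiag.1 h).1
  right_inv _ := rfl

/-- A tuple of positive degree together with a common divisor is the same as a tuple of positive
degree (the quotient) together with a positive integer. -/
def sigmaDivisorsEquiv (k : ℕ) :
    (Σ n : {m : Fin k → ℕ // 1 ≤ ∑ i, m i}, {d : ℕ // d ∈ (Finset.univ.gcd n.1).divisors}) ≃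
      {m : Fin k → ℕ // 1 ≤ ∑ i, m i} × ℕ+ where
  toFun x := (⟨fun i => x.1.1 i / x.2.1, by
    have hdn : ∀ i, x.2.1 ∣ x.1.1 i := fun i =>
      (Nat.dvd_of_mem_divisors x.2.2).trans (Finset.gcd_dvd (Finset.mem_univ i))
    by_contra! h
    have h0 := x.1.2
    have h1 : ∑ i, x.1.1 i = x.2.1 * ∑ i, x.1.1 i / x.2.1 := by
      rw [Finset.mul_sum]
      exact Finset.sum_congr rfl fun i _ => (Nat.mul_div_cancel' (hdn i)).symm
    rw [h1, Nat.lt_one_iff.1 h] at h0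
    omega⟩, ⟨x.2.1, Nat.pos_of_mem_divisors x.2.2⟩)
  invFun p := ⟨⟨fun i => p.2 * p.1.1 i, by
      rw [← Finset.mul_sum]; exact Nat.mul_pos p.2.pos p.1.2⟩, ⟨p.2, by
      have h : 1 ≤ ∑ i, p.1.1 i := p.1.2
      refine Nat.mem_divisors.2 ⟨Finset.dvd_gcd fun i _ => Dvd.intro _ rfl, fun h0 => ?_⟩
      rw [Finset.gcd_eq_zero_iff] at h0
      rw [Finset.sum_eq_zero fun i hi =>
        (Nat.mul_eq_zero.1 (h0 i hi)).resolve_left p.2.ne_zero] at h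
      omega⟩⟩
  left_inv := fun ⟨n, d, h⟩ => by
    refine Sigma.subtype_ext (p := fun n : {m : Fin k → ℕ // 1 ≤ ∑ i, m i} =>
      (· ∈ (Finset.univ.gcd n.1).divisors)) (Subtype.ext (funext fun i => ?_)) rfl
    exact Nat.mul_div_cancel' ((Nat.dvd_of_mem_divisors h).trans
      (Finset.gcd_dvd (Finset.mem_univ i)))
  right_inv p := Prod.ext (Subtype.ext (funext fun i => Nat.mul_div_cancel_left _ p.2.pos)) rfl

theorem sum_piAntidiag_multinomial_div {K : Type*} [Field K] {k : ℕ} (w : Fin k → K) (N : ℕ) :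
    ∑ n : {n : Fin k → ℕ // n ∈ Finset.univ.piAntidiag N},
      (Nat.multinomial Finset.univ n.1 : K) / ((∑ i, n.1 i : ℕ) : K) * ∏ i, w i ^ n.1 i
      = (∑ i, w i) ^ N / N := by
  rw [Finset.sum_coe_sort (Finset.univ.piAntidiag N) (fun n =>
    (Nat.multinomial Finset.univ n : K) / ((∑ i, n i : ℕ) : K) * ∏ i, w i ^ n i),
    Finset.sum_pow_eq_sum_piAntidiag, Finset.sum_div]
  refine Finset.sum_congr rfl fun n hn => ?_
  rw [(Finset.mem_piAntidiag.1 hn).1]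
  ring

theorem summable_multinomial_div_mul_prod_pow {k : ℕ} (t : Fin k → ℝ) (ht : ∀ i, 0 ≤ t i)
    (hsum : ∑ i, t i < 1) :
    Summable (fun n : {m : Fin k → ℕ // 1 ≤ ∑ i, m i} =>
      (Nat.multinomial Finset.univ n.1 : ℝ) / ((∑ i, n.1 i : ℕ) : ℝ) * ∏ i, t i ^ n.1 i) := by
  rw [← (sigmaPiAntidiagEquiv k).summable_iff, summable_sigma_of_nonneg]
  · refine ⟨fun N => (hasSum_fintype _).summable, ?_⟩
    have h : Summable fun N : ℕ+ => (∑ i, t i) ^ (N : ℕ) :=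
      (summable_geometric_of_lt_one (Finset.sum_nonneg fun i _ => ht i) hsum).comp_injective
        PNat.coe_injective
    refine h.of_nonneg_of_le (fun N => ?_) fun N => ?_
    · exact tsum_nonneg fun n => mul_nonneg (by positivity)
        (Finset.prod_nonneg fun i _ => pow_nonneg (ht i) _)
    · rw [tsum_fintype]
      refine (sum_piAntidiag_multinomial_div t N).trans_le ?_
      exact div_le_self (pow_nonneg (Finset.sum_nonneg fun i _ => ht i) _)
        (by exact_mod_cast N.2)
  · exact fun x => mul_nonneg (by positivity)
      (Finset.prod_nonneg fun i _ => pow_nonneg (ht i) _)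

theorem hasSum_pnat_neg_log {w : ℂ} (hw : ‖w‖ < 1) :
    HasSum (fun j : ℕ+ => w ^ (j : ℕ) / (j : ℕ)) (-Complex.log (1 - w)) := by
  refine (PNat.coe_injective.hasSum_iff (f := fun j : ℕ => w ^ j / (j : ℂ)) fun j hj => ?_).2
    (Complex.hasSum_taylorSeries_neg_log hw)
  have : j = 0 := by
    by_contra h
    exact hj ⟨⟨j, Nat.pos_of_ne_zero h⟩, rfl⟩
  simp [this]

theorem hasSum_multinomial_div_mul_prod_pow {k : ℕ} (z : Fin k → ℂ) (hz : ∑ i, ‖z i‖ < 1) :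
    HasSum (fun n : {m : Fin k → ℕ // 1 ≤ ∑ i, m i} =>
      (Nat.multinomial Finset.univ n.1 : ℂ) / ((∑ i, n.1 i : ℕ) : ℂ) * ∏ i, z i ^ n.1 i)
      (-Complex.log (1 - ∑ i, z i)) := by
  have hs := summable_multinomial_div_mul_prod_pow (fun i => ‖z i‖) (fun i => norm_nonneg _) hz
  have hS : Summable (fun n : {m : Fin k → ℕ // 1 ≤ ∑ i, m i} =>
      (Nat.multinomial Finset.univ n.1 : ℂ) / ((∑ i, n.1 i : ℕ) : ℂ) * ∏ i, z i ^ n.1 i) := by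
    refine Summable.of_norm (hs.congr fun n => ?_)
    simp only [norm_mul, norm_div, norm_prod, norm_pow, Complex.norm_natCast]
  have h := ((sigmaPiAntidiagEquiv k).hasSum_iff.2 hS.hasSum).sigma
    fun N => hasSum_fintype _
  have hN : HasSum (fun N : ℕ+ => (∑ i, z i) ^ (N : ℕ) / ((N : ℕ) : ℂ)) _ :=
    h.congr_fun fun N => (sum_piAntidiag_multinomial_div z N).symm
  rw [← hN.unique (hasSum_pnat_neg_log ((norm_sum_le _ _).trans_lt hz))]
  exact hS.hasSum

theorem prod_pow_div_pow {ι K : Type*} [Fintype ι] [CommMonoid K] (w : ι → K) {n : ι → ℕ} {d : ℕ}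
    (h : ∀ i, d ∣ n i) : (∏ i, w i ^ (n i / d)) ^ d = ∏ i, w i ^ n i := by
  rw [← Finset.prod_pow]
  exact Finset.prod_congr rfl fun i _ => by rw [← pow_mul, Nat.div_mul_cancel (h i)]

theorem hasSum_natCast_mul_log_one_sub_prod_pow {k : ℕ} (z : Fin k → ℂ) (hz : ∑ i, ‖z i‖ < 1)
    (Mn : (Fin k → ℕ) → ℕ)
    (hMn : ∀ m : Fin k → ℕ, 1 ≤ ∑ i, m i → (Mn m : ℚ) = WittM m)
    (hlt : ∀ m : {m : Fin k → ℕ // 1 ≤ ∑ i, m i}, ‖∏ i, z i ^ m.1 i‖ < 1) :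
    HasSum (fun m : {m : Fin k → ℕ // 1 ≤ ∑ i, m i} =>
      (Mn m.1 : ℂ) * Complex.log (1 - ∏ i, z i ^ m.1 i)) (Complex.log (1 - ∑ i, z i)) := by
  set a : {m : Fin k → ℕ // 1 ≤ ∑ i, m i} × ℕ+ → ℂ := fun p =>
    (Mn p.1.1 : ℂ) * ((∏ i, z i ^ p.1.1 i) ^ (p.2 : ℕ) / (p.2 : ℕ))
  have ha : ∀ x, a (sigmaDivisorsEquiv k x) =
      (((Mn (fun i => x.1.1 i / x.2.1) : ℚ) / (x.2.1 : ℚ) : ℚ) : ℂ) * ∏ i, z i ^ x.1.1 i := by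
    intro x
    change (Mn (fun i => x.1.1 i / x.2.1) : ℂ) *
      ((∏ i, z i ^ (x.1.1 i / x.2.1)) ^ x.2.1 / (x.2.1 : ℂ)) = _
    rw [prod_pow_div_pow z fun i =>
      (Nat.dvd_of_mem_divisors x.2.2).trans (Finset.gcd_dvd (Finset.mem_univ i))]
    push_cast
    ring
  have hq : ∀ n : {m : Fin k → ℕ // 1 ≤ ∑ i, m i},
      ∑ d : {d : ℕ // d ∈ (Finset.univ.gcd n.1).divisors},
        ((Mn (fun i => n.1 i / d.1) : ℚ) / (d.1 : ℚ)) =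
      (Nat.multinomial Finset.univ n.1 : ℚ) / ((∑ i, n.1 i : ℕ) : ℚ) := by
    intro n
    rw [← sum_divisors_WittM_div n.1 n.2, ← Finset.sum_coe_sort (Finset.univ.gcd n.1).divisors
      (fun d => WittM (fun i => n.1 i / d) / (d : ℚ))]
    exact Finset.sum_congr rfl fun d _ =>
      congrArg (· / (d.1 : ℚ)) (hMn _ (sigmaDivisorsEquiv k ⟨n, d⟩).1.2)
  have hsa : Summable a := by
    rw [← (sigmaDivisorsEquiv k).summable_iff]
    refine Summable.of_norm ?_
    rw [summable_sigma_of_nonneg fun x => norm_nonneg _]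
    refine ⟨fun n => (hasSum_fintype _).summable, ?_⟩
    have hs := summable_multinomial_div_mul_prod_pow (fun i => ‖z i‖) (fun i => norm_nonneg _) hz
    refine hs.congr fun n => ?_
    rw [tsum_fintype]
    have h := congrArg (Rat.cast : ℚ → ℝ) (hq n)
    push_cast at h
    push_cast
    rw [← h, Finset.sum_mul]
    refine Finset.sum_congr rfl fun d _ => ?_
    simp only [Function.comp_apply, ha]
    simp [norm_prod]
  have hrow : HasSum (fun m : {m : Fin k → ℕ // 1 ≤ ∑ i, m i} =>
      (Mn m.1 : ℂ) * -Complex.log (1 - ∏ i, z i ^ m.1 i)) (∑' p, a p) := by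
    have hs : ∀ m : {m : Fin k → ℕ // 1 ≤ ∑ i, m i}, HasSum (fun j : ℕ+ => a (m, j))
        ((Mn m.1 : ℂ) * -Complex.log (1 - ∏ i, z i ^ m.1 i)) := fun m =>
      (hasSum_pnat_neg_log (hlt m)).mul_left (Mn m.1 : ℂ)
    exact hsa.hasSum.prod_fiberwise hs
  have hcol : HasSum (fun n : {m : Fin k → ℕ // 1 ≤ ∑ i, m i} =>
      (Nat.multinomial Finset.univ n.1 : ℂ) / ((∑ i, n.1 i : ℕ) : ℂ) * ∏ i, z i ^ n.1 i)
      (∑' p, a p) := by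
    have hs := ((sigmaDivisorsEquiv k).hasSum_iff.2 hsa.hasSum).sigma fun n => hasSum_fintype _
    refine hs.congr_fun fun n => ?_
    have h := congrArg (Rat.cast : ℚ → ℂ) (hq n)
    rw [Rat.cast_div, Rat.cast_natCast, Rat.cast_natCast, Rat.cast_sum] at h
    rw [← h, Finset.sum_mul]
    exact Finset.sum_congr rfl fun d _ => (ha ⟨n, d⟩).symm
  rw [hcol.unique (hasSum_multinomial_div_mul_prod_pow z hz)] at hrow
  simpa using hrow.neg

theorem norm_prod_pow_lt_one {k : ℕ} (z : Fin k → ℂ) (hz : ∀ i, ‖z i‖ < 1) (m : Fin k → ℕ)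
    (hm : 1 ≤ ∑ i, m i) : ‖∏ i, z i ^ m i‖ < 1 := by
  obtain ⟨j, hj⟩ : ∃ j, m j ≠ 0 := by
    by_contra! h
    simp [h] at hm
  rw [norm_prod, ← Finset.mul_prod_erase _ _ (Finset.mem_univ j), norm_pow]
  refine mul_lt_one_of_nonneg_of_lt_one_left (by positivity)
    (pow_lt_one₀ (norm_nonneg _) (hz j) hj) ?_
  refine Finset.prod_le_one (fun i _ => norm_nonneg _) fun i _ => ?_
  rw [norm_pow]
  exact pow_le_one₀ (norm_nonneg _) (hz i).le

/-- (Witt's generalization of the necklace identity.)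
Let `k ≥ 1` and let `z_1, …, z_k` be complex numbers with `|z_1| + ⋯ + |z_k| ≤ 1/2`.
Then, `M(m_1, …, m_k)` being a nonnegative integer, the family
`(1 - z_1^{m_1} ⋯ z_k^{m_k})^{M(m_1, …, m_k)}` indexed by tuples with `m_1 + ⋯ + m_k ≥ 1`
is multipliable, with product `1 - (z_1 + ⋯ + z_k)`. -/
theorem stmt9 (k : ℕ) (hk : 1 ≤ k) (z : Fin k → ℂ)
    (hz : ∑ i, ‖z i‖ ≤ 1 / 2)
    (Mn : (Fin k → ℕ) → ℕ)
    (hMn : ∀ m : Fin k → ℕ, 1 ≤ ∑ i, m i → (Mn m : ℚ) = WittM m) :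
    Multipliable (fun m : {m : Fin k → ℕ // 1 ≤ ∑ i, m i} =>
      (1 - ∏ i, z i ^ m.1 i) ^ Mn m.1) ∧
    (∏' m : {m : Fin k → ℕ // 1 ≤ ∑ i, m i}, (1 - ∏ i, z i ^ m.1 i) ^ Mn m.1)
      = 1 - ∑ i, z i := by
  have hz1 : ∑ i, ‖z i‖ < 1 := by linarith
  have hzi : ∀ i, ‖z i‖ < 1 := fun i =>
    (Finset.single_le_sum (fun j _ => norm_nonneg (z j)) (Finset.mem_univ i)).trans_lt hz1
  have hlt : ∀ m : {m : Fin k → ℕ // 1 ≤ ∑ i, m i}, ‖∏ i, z i ^ m.1 i‖ < 1 :=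
    fun m => norm_prod_pow_lt_one z hzi m.1 m.2
  have hne : ∀ w : ℂ, ‖w‖ < 1 → 1 - w ≠ 0 := fun w hw h => by
    rw [← sub_eq_zero.1 h] at hw
    simp at hw
  have h := (hasSum_natCast_mul_log_one_sub_prod_pow z hz1 Mn hMn hlt).cexp
  rw [Complex.exp_log (hne _ ((norm_sum_le _ _).trans_lt hz1))] at h
  have hprod : HasProd (fun m : {m : Fin k → ℕ // 1 ≤ ∑ i, m i} =>
      (1 - ∏ i, z i ^ m.1 i) ^ Mn m.1) (1 - ∑ i, z i) :=
    h.congr_fun fun m => by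
      simp only [Function.comp_apply]
      rw [Complex.exp_nat_mul, Complex.exp_log (hne _ (hlt m))]
  exact ⟨hprod.multipliable, hprod.tprod_eq⟩
end

section
/- Let F and G be polynomials in ℂ[t] with G(0) = 1 and F(0) = 0. Let β ≥ 2 be a real number such that 1/|ρ| ≤ β for every root ρ of G and every root ρ of G − F. Let t be a complex number with |t| < 1/β and let J ≥ 1 be an integer. Then Σ_{j ≥ J+1} |t|^j · |b_{G−F}(j) − b_G(j)| ≤ 4·max(deg(G − F), deg G) · |tβ|^{J+1} / ((1 − |tβ|)·(J + 1)). -/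
/-- For a polynomial `H` with `H(0) = 1`, writing `H(t) = ∏ (1 - α_i t)` with the `α_i`
the inverses of the roots of `H`, `s_H(k) = Σ_i α_i^k`. -/
noncomputable def sH (H : Polynomial ℂ) (k : ℕ) : ℂ :=
  (H.roots.map fun ρ => ρ⁻¹ ^ k).sum

/-- `b_H(k) = (1/k) Σ_{d ∣ k} μ(k/d) s_H(d)`. -/
noncomputable def bH (H : Polynomial ℂ) (k : ℕ) : ℂ :=
  (1 / (k : ℂ)) * ∑ d ∈ k.divisors, (ArithmeticFunction.moebius (k / d) : ℂ) * sH H d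

theorem norm_sH_le {H : Polynomial ℂ} {β : ℝ} (h : ∀ ρ : ℂ, H.eval ρ = 0 → 1 / ‖ρ‖ ≤ β)
    (k : ℕ) : ‖sH H k‖ ≤ H.natDegree * β ^ k := by
  rcases le_or_gt 0 β with hβ | hβ
  · have hroot : ∀ x ∈ (H.roots.map fun ρ => ρ⁻¹ ^ k).map norm, x ≤ β ^ k := by
      intro x hx
      simp only [Multiset.mem_map, exists_exists_and_eq_and] at hx
      obtain ⟨ρ, hρ, rfl⟩ := hx
      rw [norm_pow, norm_inv, ← one_div]
      exact pow_le_pow_left₀ (by positivity) (h ρ (Polynomial.isRoot_of_mem_roots hρ)) k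
    calc ‖sH H k‖ ≤ ((H.roots.map fun ρ => ρ⁻¹ ^ k).map norm).sum := norm_multiset_sum_le _
      _ ≤ H.roots.card * β ^ k := by
        simpa using Multiset.sum_le_card_nsmul _ _ hroot
      _ ≤ H.natDegree * β ^ k := by
        gcongr
        exact Polynomial.card_roots' H
  · have hempty : H.roots = 0 := Multiset.eq_zero_of_forall_notMem fun ρ hρ =>
      absurd ((h ρ (Polynomial.isRoot_of_mem_roots hρ)).trans_lt hβ) (by simp)
    have hdeg : H.natDegree = 0 := by
      rw [(IsAlgClosed.splits H).natDegree_eq_card_roots, hempty, Multiset.card_zero]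
    simp [sH, hempty, hdeg]

theorem sum_range_succ_pow_le {β : ℝ} (hβ : 2 ≤ β) (k : ℕ) :
    ∑ d ∈ Finset.range (k + 1), β ^ d ≤ 2 * β ^ k := by
  induction k with
  | zero => simp
  | succ k ih =>
    rw [Finset.sum_range_succ, pow_succ]
    nlinarith [pow_nonneg (by linarith : (0 : ℝ) ≤ β) k]

theorem sum_divisors_pow_le {β : ℝ} (hβ : 2 ≤ β) (k : ℕ) :
    ∑ d ∈ k.divisors, β ^ d ≤ 2 * β ^ k := by
  refine (Finset.sum_le_sum_of_subset_of_nonneg (fun d hd => ?_) fun d _ _ => ?_).trans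
    (sum_range_succ_pow_le hβ k)
  · exact Finset.mem_range_succ_iff.mpr (Nat.divisor_le hd)
  · positivity

theorem norm_bH_le {H : Polynomial ℂ} {β : ℝ} (hβ : 2 ≤ β)
    (h : ∀ ρ : ℂ, H.eval ρ = 0 → 1 / ‖ρ‖ ≤ β) (k : ℕ) :
    ‖bH H k‖ ≤ 2 * H.natDegree * β ^ k / k := by
  have hterm : ∀ d ∈ k.divisors,
      ‖(ArithmeticFunction.moebius (k / d) : ℂ) * sH H d‖ ≤ H.natDegree * β ^ d := by
    intro d _
    have hμ : ‖(ArithmeticFunction.moebius (k / d) : ℂ)‖ ≤ 1 := by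
      rw [Complex.norm_intCast]
      exact_mod_cast ArithmeticFunction.abs_moebius_le_one
    rw [norm_mul]
    exact (mul_le_of_le_one_left (norm_nonneg _) hμ).trans (norm_sH_le h d)
  calc ‖bH H k‖ = 1 / k * ‖∑ d ∈ k.divisors,
        (ArithmeticFunction.moebius (k / d) : ℂ) * sH H d‖ := by simp [bH]
    _ ≤ 1 / k * (H.natDegree * (2 * β ^ k)) := by
      gcongr
      refine (norm_sum_le_of_le _ hterm).trans ?_
      rw [← Finset.mul_sum]
      gcongr
      exact sum_divisors_pow_le hβ k
    _ = 2 * H.natDegree * β ^ k / k := by ring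

/-- Let `F, G ∈ ℂ[t]` with `G(0) = 1` and `F(0) = 0`, let `β ≥ 2` dominate the inverses of the
roots of `G` and of `G - F`, let `t` be complex with `|t| < 1/β`, and let `J ≥ 1`.  Then
`Σ_{j ≥ J+1} |t|^j |b_{G-F}(j) - b_G(j)|
   ≤ 4 max(deg(G-F), deg G) |tβ|^{J+1} / ((1 - |tβ|) (J+1))`. -/
theorem stmt14 (F G : Polynomial ℂ) (hG0 : G.coeff 0 = 1) (hF0 : F.coeff 0 = 0)
    (β : ℝ) (hβ : 2 ≤ β)
    (hGroots : ∀ ρ : ℂ, G.eval ρ = 0 → 1 / ‖ρ‖ ≤ β)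
    (hGFroots : ∀ ρ : ℂ, (G - F).eval ρ = 0 → 1 / ‖ρ‖ ≤ β)
    (t : ℂ) (ht : ‖t‖ < 1 / β) (J : ℕ) (hJ : 1 ≤ J) :
    Summable (fun j : ℕ =>
      ‖t‖ ^ (J + 1 + j) * ‖bH (G - F) (J + 1 + j) - bH G (J + 1 + j)‖) ∧
    (∑' j : ℕ, ‖t‖ ^ (J + 1 + j) * ‖bH (G - F) (J + 1 + j) - bH G (J + 1 + j)‖)
      ≤ 4 * max ((G - F).natDegree) G.natDegree * (‖t‖ * β) ^ (J + 1) /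
          ((1 - ‖t‖ * β) * (J + 1)) := by
  have hβ0 : 0 < β := by linarith
  set M : ℝ := max ((G - F).natDegree : ℝ) G.natDegree with hM
  have hM0 : 0 ≤ M := le_max_of_le_left (Nat.cast_nonneg _)
  set r : ℝ := ‖t‖ * β with hr
  have hr0 : 0 ≤ r := by positivity
  have hr1 : r < 1 := (lt_div_iff₀ hβ0).mp ht
  have hbound : ∀ j : ℕ, ‖t‖ ^ (J + 1 + j) * ‖bH (G - F) (J + 1 + j) - bH G (J + 1 + j)‖ ≤
      4 * M * r ^ (J + 1) / (J + 1) * r ^ j := by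
    intro j
    have hdiff : ‖bH (G - F) (J + 1 + j) - bH G (J + 1 + j)‖ ≤
        4 * M * β ^ (J + 1 + j) / (J + 1) := by
      calc _ ≤ ‖bH (G - F) (J + 1 + j)‖ + ‖bH G (J + 1 + j)‖ := norm_sub_le _ _
        _ ≤ 2 * M * β ^ (J + 1 + j) / (J + 1 + j : ℕ) +
            2 * M * β ^ (J + 1 + j) / (J + 1 + j : ℕ) := by
          refine add_le_add ((norm_bH_le hβ hGFroots _).trans ?_)
            ((norm_bH_le hβ hGroots _).trans ?_)
          · gcongr
            exact le_max_left _ _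
          · gcongr
            exact le_max_right _ _
        _ = 4 * M * β ^ (J + 1 + j) / (J + 1 + j : ℕ) := by ring
        _ ≤ 4 * M * β ^ (J + 1 + j) / (J + 1) := by
          gcongr
          push_cast
          linarith [(Nat.cast_nonneg j : (0 : ℝ) ≤ j)]
    calc _ ≤ ‖t‖ ^ (J + 1 + j) * (4 * M * β ^ (J + 1 + j) / (J + 1)) := by gcongr
      _ = 4 * M * r ^ (J + 1) / (J + 1) * r ^ j := by
        rw [hr]
        ring
  have hgeom : HasSum (fun j : ℕ => 4 * M * r ^ (J + 1) / (J + 1) * r ^ j)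
      (4 * M * r ^ (J + 1) / (J + 1) * (1 - r)⁻¹) :=
    (hasSum_geometric_of_lt_one hr0 hr1).mul_left _
  have hsum := Summable.of_nonneg_of_le (fun j => by positivity) hbound hgeom.summable
  refine ⟨hsum, (hsum.tsum_le_tsum hbound hgeom.summable).trans_eq ?_⟩
  rw [hgeom.tsum_eq]
  push_cast
  rw [← hM, div_mul_eq_mul_div, ← div_eq_mul_inv, div_div]
end
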